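/- Theorem 1 (lower bound of the marginal likelihood). Under the clipped GLM setup, suppose a_n > 0, λ_n satisfies Assumption L₀, n, d_n → ∞ with d_n > n, n is large enough that b_n log d_n < n, and the true parameter β* belongs to B_{2,n}. Then there is an absolute constant c > 0 such that for all sufficiently large n, with probability at least 1 − (s_n* log d_n)^{-1} under the data-generating distribution, the marginal likelihood satisfies ∫ exp(L_n(η,η*)) dΠ_n(β) ≥ c · C_n · d_n^{−(a_n+6) s_n*} · exp(−λ_n ||β*||₁). -/

import Mathlib

open MeasureTheory Real Filter

noncomputable section

/-- Density of a one-parameter canonical exponential family member with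
canonical parameter `θ`, base function `h`, sufficient statistic `T` and
log-partition function `A`. -/
def expFamDensity (h T A : ℝ → ℝ) (θ : ℝ) (y : ℝ) : ℝ :=
  h y * Real.exp (θ * T y - A θ)

/-- The exponential family member as a measure on `ℝ`. -/
def expFamMeasure (μ : Measure ℝ) (h T A : ℝ → ℝ) (θ : ℝ) : Measure ℝ :=
  μ.withDensity fun y => ENNReal.ofReal (expFamDensity h T A θ y)

/-- Joint distribution of `n` independent observations with parameters `θ i`. -/
def dataMeasure (μ : Measure ℝ) (h T A : ℝ → ℝ) (n : ℕ) (θ : Fin n → ℝ) :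
    Measure (Fin n → ℝ) :=
  Measure.pi fun i => expFamMeasure μ h T A (θ i)

/-- The ℓ₁ norm on `ℝ^m`. -/
def l1 {m : ℕ} (v : Fin m → ℝ) : ℝ := ∑ j, |v j|

/-- The support (set of nonzero coordinates) of a vector. -/
def suppSet {m : ℕ} (v : Fin m → ℝ) : Finset (Fin m) :=
  Finset.univ.filter fun j => v j ≠ 0

/-- `restr S v` agrees with `v` on `S` and is zero off `S`. -/
def restr {m : ℕ} (S : Finset (Fin m)) (v : Fin m → ℝ) : Fin m → ℝ :=
  fun j => if j ∈ S then v j else 0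

/-- The Laplace distribution with rate `lam` as a measure on `ℝ`. -/
def laplaceMeasure (lam : ℝ) : Measure ℝ :=
  volume.withDensity fun x => ENNReal.ofReal (lam / 2 * Real.exp (-(lam * |x|)))

/-- Given a model `S`, independent Laplace coordinates on `S` and point
masses at zero off `S`. -/
def modelMeasure (dn : ℕ) (lam : ℝ) (S : Finset (Fin dn)) : Measure (Fin dn → ℝ) :=
  Measure.pi fun j => if j ∈ S then laplaceMeasure lam else Measure.dirac 0

/-- The spike-and-Laplace complexity prior `Π_n` on `ℝ^{d_n}` with
hyperparameters `lam = λ_n`, `a = a_n` and normalizer `C = C_n`. -/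
def priorMeasure (dn : ℕ) (lam a C : ℝ) : Measure (Fin dn → ℝ) :=
  ∑ S : Finset (Fin dn),
    ENNReal.ofReal (C * ((dn.choose S.card : ℝ))⁻¹ * ((dn : ℝ) ^ (-a)) ^ S.card) •
      modelMeasure dn lam S

/-- `η_i = η(x_iᵀ β)`. -/
def etaVec (ηf : ℝ → ℝ) {n dn : ℕ} (X : Matrix (Fin n) (Fin dn) ℝ) (β : Fin dn → ℝ)
    (i : Fin n) : ℝ :=
  ηf (∑ j, X i j * β j)

/-- The Kullback--Leibler divergence `D_n(θ* ‖ θ)`, expressed as the Bregman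
divergence of the log-partition function. -/
def klDiv (A : ℝ → ℝ) {n : ℕ} (θstar θ : Fin n → ℝ) : ℝ :=
  ∑ i, (A (θ i) - A (θstar i) - (θ i - θstar i) * deriv A (θstar i))

/-- The centered stochastic term `Z_n(θ, θ*)`; `ET i` is the mean of `T(y_i)`. -/
def centeredZ (T : ℝ → ℝ) {n : ℕ} (ET θstar θ : Fin n → ℝ) (y : Fin n → ℝ) : ℝ :=
  ∑ i, (T (y i) - ET i) * (θ i - θstar i)

/-- The log-likelihood ratio `L_n(η, η*) = Z_n(η, η*) - D_n(η* ‖ η)`. -/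
def logLR (μ : Measure ℝ) (h T A ηf : ℝ → ℝ) {n dn : ℕ} (X : Matrix (Fin n) (Fin dn) ℝ)
    (βstar β : Fin dn → ℝ) (y : Fin n → ℝ) : ℝ :=
  centeredZ T (fun i => ∫ z, T z ∂(expFamMeasure μ h T A (etaVec ηf X βstar i)))
      (etaVec ηf X βstar) (etaVec ηf X β) y
    - klDiv A (etaVec ηf X βstar) (etaVec ηf X β)

/-- The marginal likelihood `∫ exp(L_n(η,η*)) dΠ_n(β)`. -/
def marginalLik (μ : Measure ℝ) (h T A ηf : ℝ → ℝ) {n : ℕ} (dn : ℕ)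
    (X : Matrix (Fin n) (Fin dn) ℝ) (βstar : Fin dn → ℝ) (lam a C : ℝ)
    (y : Fin n → ℝ) : ℝ :=
  ∫ β, Real.exp (logLR μ h T A ηf X βstar β y) ∂(priorMeasure dn lam a C)

/-- The posterior probability of a set `B` given data `y`. -/
def posterior (μ : Measure ℝ) (h T A ηf : ℝ → ℝ) {n : ℕ} (dn : ℕ)
    (X : Matrix (Fin n) (Fin dn) ℝ) (βstar : Fin dn → ℝ) (lam a C : ℝ)
    (B : Set (Fin dn → ℝ)) (y : Fin n → ℝ) : ℝ :=
  (∫ β in B, Real.exp (logLR μ h T A ηf X βstar β y) ∂(priorMeasure dn lam a C)) /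
    marginalLik μ h T A ηf dn X βstar lam a C y

/-- `‖X‖_{(∞,∞)} = max_{i,j} |X_{ij}|`. -/
def Xnorm {n dn : ℕ} (X : Matrix (Fin n) (Fin dn) ℝ) : ℝ := ⨆ i, ⨆ j, |X i j|

/-- `M(A, X) = ‖X‖_{(∞,∞)} · M₁(A)` with `M₁(A) = (1 ⊓ M₀(A)⁻¹)⁻¹`. -/
def Mconst (M0 : ℝ) {n dn : ℕ} (X : Matrix (Fin n) (Fin dn) ℝ) : ℝ :=
  Xnorm X * (min 1 M0⁻¹)⁻¹

theorem isOpen_range_of_continuous_injective {f : ℝ → ℝ} (hf : Continuous f)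
    (hinj : Function.Injective f) : IsOpen (Set.range f) := by
  have hoc : (Set.range f).OrdConnected := (isPreconnected_range hf).ordConnected
  rw [isOpen_iff_mem_nhds]
  rintro _ ⟨t, rfl⟩
  rcases hf.strictMono_of_inj hinj with hm | hm
  · exact Filter.mem_of_superset (Icc_mem_nhds (hm (sub_one_lt t)) (hm (lt_add_one t)))
      (hoc.out ⟨_, rfl⟩ ⟨_, rfl⟩)
  · exact Filter.mem_of_superset (Icc_mem_nhds (hm (lt_add_one t)) (hm (sub_one_lt t)))
      (hoc.out ⟨_, rfl⟩ ⟨_, rfl⟩)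

/-- Quadratic upper bound on a Bregman divergence. -/
theorem bregman_le_of_deriv2_le {A : ℝ → ℝ} {J : Set ℝ} {K : ℝ} (hJo : IsOpen J)
    (hJ : J.OrdConnected) (hA : ContDiffOn ℝ 2 A J) (hK : ∀ x ∈ J, deriv (deriv A) x ≤ K)
    {x y : ℝ} (hx : x ∈ J) (hy : y ∈ J) :
    A y - A x - (y - x) * deriv A x ≤ K / 2 * (y - x) ^ 2 := by
  have hd : ∀ z ∈ J, HasDerivAt A (deriv A z) z := fun z hz =>
    ((hA.differentiableOn (by norm_num)).differentiableAt (hJo.mem_nhds hz)).hasDerivAt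
  have hd2 : ∀ z ∈ J, HasDerivAt (deriv A) (deriv (deriv A) z) z := fun z hz =>
    ((((contDiffOn_succ_iff_deriv_of_isOpen (n := 1) hJo).1 hA).2.2.differentiableOn
      (by norm_num)).differentiableAt (hJo.mem_nhds hz)).hasDerivAt
  set G : ℝ → ℝ := fun z => K / 2 * (z - x) ^ 2 - (A z - A x - (z - x) * deriv A x) with hG
  set G' : ℝ → ℝ := fun z => K * (z - x) - (deriv A z - deriv A x) with hG'
  have hGd : ∀ z ∈ J, HasDerivAt G (G' z) z := fun z hz => by
    have h1 := ((((hasDerivAt_id z).sub_const x).pow 2).const_mul (K / 2)).sub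
      (((hd z hz).sub_const (A x)).sub (((hasDerivAt_id z).sub_const x).mul_const (deriv A x)))
    refine h1.congr_deriv ?_
    simp [hG']
    ring
  have hG'd : ∀ z ∈ J, HasDerivAt G' (K - deriv (deriv A) z) z := fun z hz => by
    have h1 := (((hasDerivAt_id z).sub_const x).const_mul K).sub
      ((hd2 z hz).sub_const (deriv A x))
    refine h1.congr_deriv ?_
    simp
  have hint : interior J = J := hJo.interior_eq
  have hconv : ConvexOn ℝ J G := by
    refine convexOn_of_hasDerivWithinAt2_nonneg (f' := G') (f'' := fun z => K - deriv (deriv A) z)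
      hJ.convex (fun z hz => (hGd z hz).continuousAt.continuousWithinAt) ?_ ?_ ?_
    · intro z hz; exact (hGd z (hint ▸ hz)).hasDerivWithinAt
    · intro z hz; exact (hG'd z (hint ▸ hz)).hasDerivWithinAt
    · intro z hz; exact sub_nonneg.2 (hK z (hint ▸ hz))
  have hGx : G x = 0 := by simp [hG]
  have hG'x : G' x = 0 := by simp [hG']
  have hmain : 0 ≤ G y := by
    rcases lt_trichotomy x y with hxy | hxy | hxy
    · have := hconv.le_slope_of_hasDerivAt hx hy hxy (hG'x ▸ hGd x hx)
      rw [slope_def_field, hGx, sub_zero] at this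
      by_contra hneg
      exact absurd this (not_le.2 (div_neg_of_neg_of_pos (not_le.1 hneg) (by linarith)))
    · rw [← hxy, hGx]
    · have := hconv.slope_le_of_hasDerivAt hy hx hxy (hG'x ▸ hGd x hx)
      rw [slope_def_field, hGx, zero_sub] at this
      by_contra hneg
      exact absurd this (not_le.2 (div_pos (by linarith [not_le.1 hneg]) (by linarith)))
  simp only [hG] at hmain
  linarith

section ExpFam

variable {μ : Measure ℝ} {h T A : ℝ → ℝ} {θ s : ℝ}

theorem measurable_expFamDensity (hmh : Measurable h) (hmT : Measurable T) :
    Measurable (expFamDensity h T A θ) := by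
  unfold expFamDensity; fun_prop

/-- The exponential moments of the sufficient statistic. -/
theorem lintegral_exp_expFamMeasure (hh : ∀ y, 0 ≤ h y) (hmh : Measurable h) (hmT : Measurable T)
    (hp : IsProbabilityMeasure (expFamMeasure μ h T A (θ + s))) (c : ℝ) :
    ∫⁻ y, ENNReal.ofReal (Real.exp (s * T y + c)) ∂(expFamMeasure μ h T A θ) =
      ENNReal.ofReal (Real.exp (A (θ + s) - A θ + c)) := by
  have h1 : ∫⁻ y, ENNReal.ofReal (expFamDensity h T A (θ + s) y) ∂μ = 1 := by
    rw [← hp.measure_univ, expFamMeasure, withDensity_apply _ MeasurableSet.univ,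
      Measure.restrict_univ]
  unfold expFamMeasure
  rw [lintegral_withDensity_eq_lintegral_mul _
    (measurable_expFamDensity hmh hmT).ennreal_ofReal (by fun_prop)]
  have h2 : ∀ y, ((fun y => ENNReal.ofReal (expFamDensity h T A θ y)) *
      fun y => ENNReal.ofReal (Real.exp (s * T y + c))) y =
      ENNReal.ofReal (Real.exp (A (θ + s) - A θ + c)) *
        ENNReal.ofReal (expFamDensity h T A (θ + s) y) := fun y => by
    simp only [Pi.mul_apply, expFamDensity]
    rw [← ENNReal.ofReal_mul (mul_nonneg (hh y) (Real.exp_pos _).le),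
      ← ENNReal.ofReal_mul (Real.exp_pos _).le, mul_assoc, mul_left_comm (Real.exp (A (θ + s) - A θ + c)),
      ← Real.exp_add, ← Real.exp_add]
    ring_nf
  rw [lintegral_congr h2, lintegral_const_mul _
    (measurable_expFamDensity hmh hmT).ennreal_ofReal, h1, mul_one]

theorem integrable_exp_expFamMeasure (hh : ∀ y, 0 ≤ h y) (hmh : Measurable h) (hmT : Measurable T)
    (hp : IsProbabilityMeasure (expFamMeasure μ h T A (θ + s))) :
    Integrable (fun y => Real.exp (s * T y)) (expFamMeasure μ h T A θ) := by
  refine (lintegral_ofReal_ne_top_iff_integrable (by fun_prop)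
    (ae_of_all _ fun y => (Real.exp_pos _).le)).1 ?_
  have := lintegral_exp_expFamMeasure hh hmh hmT hp 0
  simp only [add_zero] at this
  rw [this]
  exact ENNReal.ofReal_ne_top

theorem cgf_expFamMeasure (hh : ∀ y, 0 ≤ h y) (hmh : Measurable h) (hmT : Measurable T)
    (hp : IsProbabilityMeasure (expFamMeasure μ h T A (θ + s))) :
    ProbabilityTheory.cgf T (expFamMeasure μ h T A θ) s = A (θ + s) - A θ := by
  have := lintegral_exp_expFamMeasure hh hmh hmT hp 0
  simp only [add_zero] at this
  rw [ProbabilityTheory.cgf, ProbabilityTheory.mgf,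
    integral_eq_lintegral_of_nonneg_ae (ae_of_all _ fun y => (Real.exp_pos _).le) (by fun_prop),
    this, ENNReal.toReal_ofReal (Real.exp_pos _).le, Real.log_exp]

variable {J : Set ℝ}

theorem zero_mem_interior_integrableExpSet (hh : ∀ y, 0 ≤ h y) (hmh : Measurable h)
    (hmT : Measurable T) (hJo : IsOpen J)
    (hp : ∀ θ ∈ J, IsProbabilityMeasure (expFamMeasure μ h T A θ)) (hθ : θ ∈ J) :
    0 ∈ interior (ProbabilityTheory.integrableExpSet T (expFamMeasure μ h T A θ)) := by
  rw [mem_interior_iff_mem_nhds]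
  have : (fun s => θ + s) ⁻¹' J ∈ nhds (0 : ℝ) :=
    (hJo.preimage (by fun_prop)).mem_nhds (by simpa using hθ)
  filter_upwards [this] with s hs
  exact integrable_exp_expFamMeasure hh hmh hmT (hp _ hs)

theorem cgf_expFamMeasure_eventuallyEq (hh : ∀ y, 0 ≤ h y) (hmh : Measurable h)
    (hmT : Measurable T) (hJo : IsOpen J)
    (hp : ∀ θ ∈ J, IsProbabilityMeasure (expFamMeasure μ h T A θ)) (hθ : θ ∈ J) :
    ProbabilityTheory.cgf T (expFamMeasure μ h T A θ) =ᶠ[nhds 0] fun s => A (θ + s) - A θ := by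
  have : (fun s => θ + s) ⁻¹' J ∈ nhds (0 : ℝ) :=
    (hJo.preimage (by fun_prop)).mem_nhds (by simpa using hθ)
  filter_upwards [this] with s hs
  exact cgf_expFamMeasure hh hmh hmT (hp _ hs)

theorem integral_expFamMeasure (hh : ∀ y, 0 ≤ h y) (hmh : Measurable h)
    (hmT : Measurable T) (hJo : IsOpen J)
    (hp : ∀ θ ∈ J, IsProbabilityMeasure (expFamMeasure μ h T A θ)) (hθ : θ ∈ J) :
    ∫ y, T y ∂(expFamMeasure μ h T A θ) = deriv A θ := by
  have := hp θ hθ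
  have h1 := ProbabilityTheory.deriv_cgf_zero
    (zero_mem_interior_integrableExpSet hh hmh hmT hJo hp hθ)
  rw [(cgf_expFamMeasure_eventuallyEq hh hmh hmT hJo hp hθ).deriv_eq, deriv_sub_const,
    deriv_comp_const_add] at h1
  simpa using h1.symm

theorem variance_expFamMeasure (hh : ∀ y, 0 ≤ h y) (hmh : Measurable h)
    (hmT : Measurable T) (hJo : IsOpen J)
    (hp : ∀ θ ∈ J, IsProbabilityMeasure (expFamMeasure μ h T A θ)) (hθ : θ ∈ J) :
    ProbabilityTheory.variance T (expFamMeasure μ h T A θ) = deriv (deriv A) θ := by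
  have := hp θ hθ
  have h1 := ProbabilityTheory.variance_tilted_mul
    (zero_mem_interior_integrableExpSet hh hmh hmT hJo hp hθ)
  have h2 : deriv (fun s => A (θ + s) - A θ) = fun s => deriv A (θ + s) := by
    funext s
    rw [deriv_sub_const, deriv_comp_const_add]
  rw [(cgf_expFamMeasure_eventuallyEq hh hmh hmT hJo hp hθ).iteratedDeriv_eq, iteratedDeriv_succ,
    iteratedDeriv_one, h2, deriv_comp_const_add] at h1
  simpa using h1

/-- The first absolute central moment of the sufficient statistic is at most any bound on its
standard deviation. -/
theorem lintegral_abs_sub_mean_le {M : ℝ} (hM : 0 < M) (hh : ∀ y, 0 ≤ h y) (hmh : Measurable h)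
    (hmT : Measurable T) (hJo : IsOpen J)
    (hp : ∀ θ ∈ J, IsProbabilityMeasure (expFamMeasure μ h T A θ)) (hθ : θ ∈ J)
    (hA : deriv (deriv A) θ ≤ M ^ 2) :
    ∫⁻ y, ENNReal.ofReal |T y - ∫ z, T z ∂(expFamMeasure μ h T A θ)|
      ∂(expFamMeasure μ h T A θ) ≤ ENNReal.ofReal M := by
  have := hp θ hθ
  set P := expFamMeasure μ h T A θ with hP
  have hL : MemLp T 2 P := by
    simpa using ProbabilityTheory.memLp_of_mem_interior_integrableExpSet
      (zero_mem_interior_integrableExpSet hh hmh hmT hJo hp hθ) 2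
  set m := ∫ z, T z ∂P with hm
  have hL' : MemLp (fun y => T y - m) 2 P := hL.sub (memLp_const m)
  have hv : ∫ y, (T y - m) ^ 2 ∂P ≤ M ^ 2 := by
    rw [← ProbabilityTheory.variance_eq_integral hmT.aemeasurable,
      variance_expFamMeasure hh hmh hmT hJo hp hθ]
    exact hA
  have hi : Integrable (fun y => |T y - m|) P := (hL'.integrable (by norm_num)).abs
  rw [← ofReal_integral_eq_lintegral_ofReal hi (ae_of_all _ fun y => abs_nonneg _)]
  refine ENNReal.ofReal_le_ofReal ?_
  have hb : ∫ y, |T y - m| ∂P ≤ ∫ y, ((T y - m) ^ 2 * (1 / (2 * M)) + M / 2) ∂P := by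
    refine integral_mono hi ((hL'.integrable_sq.mul_const _).add (integrable_const _)) fun y => ?_
    have : 0 ≤ (|T y - m| - M) ^ 2 / (2 * M) := by positivity
    have h3 : (|T y - m| - M) ^ 2 / (2 * M) =
      (T y - m) ^ 2 * (1 / (2 * M)) + M / 2 - |T y - m| := by
      rw [sub_sq, sq_abs]; field_simp; ring
    simp only
    linarith
  rw [integral_add (hL'.integrable_sq.mul_const _) (integrable_const _), integral_mul_const] at hb
  refine hb.trans ?_
  calc _ ≤ M ^ 2 * (1 / (2 * M)) + M / 2 := by
        simp only [integral_const, probReal_univ, one_smul]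
        gcongr
    _ = M := by field_simp; ring

end ExpFam

theorem lintegral_prod_pi_eq_prod {ι : Type*} [Fintype ι] {Ω : ι → Type*}
    [∀ i, MeasurableSpace (Ω i)] (P : ∀ i, Measure (Ω i)) [∀ i, IsProbabilityMeasure (P i)]
    {f : ∀ i, Ω i → ENNReal} (hf : ∀ i, Measurable (f i)) :
    ∫⁻ y, ∏ i, f i (y i) ∂(Measure.pi P) = ∏ i, ∫⁻ z, f i z ∂(P i) := by
  refine (ProbabilityTheory.lintegral_prod_eq_prod_lintegral_of_indepFun Finset.univ
    (fun i (y : ∀ i, Ω i) => f i (y i))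
    (ProbabilityTheory.iIndepFun_pi fun i => (hf i).aemeasurable)
    (fun i => (hf i).comp (measurable_pi_apply i))).trans ?_
  exact Finset.prod_congr rfl fun i _ => (measurePreserving_eval P i).lintegral_comp (hf i)

section Likelihood

variable {μ : Measure ℝ} {h T A ηf : ℝ → ℝ} {J : Set ℝ} {n dn : ℕ}
  {X : Matrix (Fin n) (Fin dn) ℝ} {βstar β : Fin dn → ℝ} {y : Fin n → ℝ}

theorem logLR_eq_sum (hh : ∀ y, 0 ≤ h y) (hmh : Measurable h) (hmT : Measurable T)
    (hJo : IsOpen J) (hp : ∀ θ ∈ J, IsProbabilityMeasure (expFamMeasure μ h T A θ))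
    (hη : ∀ t, ηf t ∈ J) :
    logLR μ h T A ηf X βstar β y =
      ∑ i, ((etaVec ηf X β i - etaVec ηf X βstar i) * T (y i) +
        -(A (etaVec ηf X β i) - A (etaVec ηf X βstar i))) := by
  unfold logLR centeredZ klDiv
  rw [← Finset.sum_sub_distrib]
  refine Finset.sum_congr rfl fun i _ => ?_
  have hmean : ∫ z, T z ∂(expFamMeasure μ h T A (etaVec ηf X βstar i)) =
      deriv A (etaVec ηf X βstar i) := integral_expFamMeasure hh hmh hmT hJo hp (hη _)
  simp only [hmean]
  ring

/-- The likelihood ratio has mean one under the true parameter. -/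
theorem lintegral_exp_logLR (hh : ∀ y, 0 ≤ h y) (hmh : Measurable h) (hmT : Measurable T)
    (hJo : IsOpen J) (hp : ∀ θ ∈ J, IsProbabilityMeasure (expFamMeasure μ h T A θ))
    (hη : ∀ t, ηf t ∈ J) :
    ∫⁻ y, ENNReal.ofReal (Real.exp (logLR μ h T A ηf X βstar β y))
      ∂(dataMeasure μ h T A n (etaVec ηf X βstar)) = 1 := by
  have hprob : ∀ i, IsProbabilityMeasure (expFamMeasure μ h T A (etaVec ηf X βstar i)) :=
    fun i => hp _ (hη _)
  have h1 : ∀ y : Fin n → ℝ, ENNReal.ofReal (Real.exp (logLR μ h T A ηf X βstar β y)) =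
      ∏ i, ENNReal.ofReal (Real.exp ((etaVec ηf X β i - etaVec ηf X βstar i) * T (y i) +
        -(A (etaVec ηf X β i) - A (etaVec ηf X βstar i)))) := fun y => by
    rw [logLR_eq_sum hh hmh hmT hJo hp hη, Real.exp_sum,
      ENNReal.ofReal_prod_of_nonneg fun i _ => (Real.exp_pos _).le]
  rw [lintegral_congr h1, dataMeasure]
  rw [lintegral_prod_pi_eq_prod (fun i => expFamMeasure μ h T A (etaVec ηf X βstar i))
    (f := fun i z => ENNReal.ofReal (Real.exp ((etaVec ηf X β i - etaVec ηf X βstar i) * T z +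
        -(A (etaVec ηf X β i) - A (etaVec ηf X βstar i))))) (fun i => by fun_prop)]
  refine Finset.prod_eq_one fun i _ => ?_
  rw [lintegral_exp_expFamMeasure hh hmh hmT (by rw [add_sub_cancel]; exact hp _ (hη _))]
  simp

theorem measurable_logLR (hmT : Measurable T) (hη : Continuous ηf)
    (hA : Measurable fun t => A (ηf t)) :
    Measurable fun p : (Fin n → ℝ) × (Fin dn → ℝ) => logLR μ h T A ηf X βstar p.2 p.1 := by
  have h2 : ∀ i, Measurable fun p : (Fin n → ℝ) × (Fin dn → ℝ) => ∑ j, X i j * p.2 j :=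
    fun i => by fun_prop
  have h1 : ∀ i, Measurable fun p : (Fin n → ℝ) × (Fin dn → ℝ) => ηf (∑ j, X i j * p.2 j) :=
    fun i => hη.measurable.comp (h2 i)
  have h3 : ∀ i, Measurable fun p : (Fin n → ℝ) × (Fin dn → ℝ) => A (ηf (∑ j, X i j * p.2 j)) :=
    fun i => hA.comp (h2 i)
  have h4 : ∀ i, Measurable fun p : (Fin n → ℝ) × (Fin dn → ℝ) => T (p.1 i) :=
    fun i => hmT.comp (by fun_prop)
  unfold logLR centeredZ klDiv etaVec
  exact (Finset.measurable_fun_sum _ fun i _ =>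
    ((h4 i).sub_const _).mul ((h1 i).sub_const _)).sub
    (Finset.measurable_fun_sum _ fun i _ =>
      ((h3 i).sub_const _).sub (((h1 i).sub_const _).mul_const _))

/-- Almost surely, the likelihood ratio is integrable with respect to a prior probability. -/
theorem ae_integrable_exp_logLR (hh : ∀ y, 0 ≤ h y) (hmh : Measurable h) (hmT : Measurable T)
    (hJo : IsOpen J) (hp : ∀ θ ∈ J, IsProbabilityMeasure (expFamMeasure μ h T A θ))
    (hηJ : ∀ t, ηf t ∈ J) (hη : Continuous ηf) (hA : Measurable fun t => A (ηf t))
    (Q : Measure (Fin dn → ℝ)) [IsProbabilityMeasure Q] :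
    ∀ᵐ y ∂(dataMeasure μ h T A n (etaVec ηf X βstar)),
      Integrable (fun β => Real.exp (logLR μ h T A ηf X βstar β y)) Q := by
  have hprob : ∀ i, IsProbabilityMeasure (expFamMeasure μ h T A (etaVec ηf X βstar i)) :=
    fun i => hp _ (hηJ _)
  have : IsProbabilityMeasure (dataMeasure μ h T A n (etaVec ηf X βstar)) := by
    unfold dataMeasure; infer_instance
  have hm : Measurable fun p : (Fin n → ℝ) × (Fin dn → ℝ) =>
      ENNReal.ofReal (Real.exp (logLR μ h T A ηf X βstar p.2 p.1)) :=
    (measurable_logLR hmT hη hA).exp.ennreal_ofReal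
  have htot : ∫⁻ y, ∫⁻ β, ENNReal.ofReal (Real.exp (logLR μ h T A ηf X βstar β y)) ∂Q
      ∂(dataMeasure μ h T A n (etaVec ηf X βstar)) = 1 := by
    rw [lintegral_lintegral_swap hm.aemeasurable]
    simp [lintegral_exp_logLR hh hmh hmT hJo hp hηJ]
  filter_upwards [ae_lt_top hm.lintegral_prod_right' (by rw [htot]; simp)] with y hy
  refine (lintegral_ofReal_ne_top_iff_integrable ?_ (ae_of_all _ fun β => (Real.exp_pos _).le)).1
    hy.ne
  exact ((measurable_logLR hmT hη hA).exp.comp measurable_prodMk_left).aestronglyMeasurable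

/-- Lower bound for the log-likelihood ratio when all canonical parameters are `δ`-close. -/
theorem neg_le_logLR {K δ : ℝ} (hK0 : 0 ≤ K)
    (hJo : IsOpen J) (hJ : J.OrdConnected) (hA : ContDiffOn ℝ 2 A J)
    (hK : ∀ x ∈ J, deriv (deriv A) x ≤ K) (hηJ : ∀ t, ηf t ∈ J)
    (hδ : ∀ i, |etaVec ηf X β i - etaVec ηf X βstar i| ≤ δ) :
    -((∑ i, |T (y i) - ∫ z, T z ∂(expFamMeasure μ h T A (etaVec ηf X βstar i))|) * δ +
      n * (K / 2 * δ ^ 2)) ≤ logLR μ h T A ηf X βstar β y := by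
  unfold logLR
  have h1 : -((∑ i, |T (y i) - ∫ z, T z ∂(expFamMeasure μ h T A (etaVec ηf X βstar i))|) * δ) ≤
      centeredZ T (fun i => ∫ z, T z ∂(expFamMeasure μ h T A (etaVec ηf X βstar i)))
      (etaVec ηf X βstar) (etaVec ηf X β) y := by
    unfold centeredZ
    rw [Finset.sum_mul, ← Finset.sum_neg_distrib]
    refine Finset.sum_le_sum fun i _ => ?_
    refine le_trans ?_ (neg_abs_le _)
    rw [abs_mul]
    exact neg_le_neg (mul_le_mul_of_nonneg_left (hδ i) (abs_nonneg _))
  have h2 : klDiv A (etaVec ηf X βstar) (etaVec ηf X β) ≤ n * (K / 2 * δ ^ 2) := by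
    unfold klDiv
    refine (Finset.sum_le_card_nsmul _ _ (K / 2 * δ ^ 2) fun i _ => ?_).trans (by simp)
    refine (bregman_le_of_deriv2_le hJo hJ hA hK (hηJ _) (hηJ _)).trans ?_
    have : (etaVec ηf X β i - etaVec ηf X βstar i) ^ 2 ≤ δ ^ 2 := by
      rw [← sq_abs]; exact pow_le_pow_left₀ (abs_nonneg _) (hδ i) 2
    exact mul_le_mul_of_nonneg_left this (by positivity)
  linarith

/-- Markov's inequality for the total absolute centred statistic. -/
theorem one_sub_le_dataMeasure {M : ℝ} (hM : 0 < M) (hh : ∀ y, 0 ≤ h y) (hmh : Measurable h)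
    (hmT : Measurable T) (hJo : IsOpen J)
    (hp : ∀ θ ∈ J, IsProbabilityMeasure (expFamMeasure μ h T A θ)) {θ : Fin n → ℝ}
    (hθ : ∀ i, θ i ∈ J) (hA : ∀ i, deriv (deriv A) (θ i) ≤ M ^ 2) (hn : 0 < n) :
    ENNReal.ofReal (1 - 1 / n) ≤ dataMeasure μ h T A n θ
      {y | ∑ i, |T (y i) - ∫ z, T z ∂(expFamMeasure μ h T A (θ i))| < M * n ^ 2} := by
  have hprob : ∀ i, IsProbabilityMeasure (expFamMeasure μ h T A (θ i)) :=
    fun i => hp _ (hθ i)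
  have : IsProbabilityMeasure (dataMeasure μ h T A n θ) := by
    unfold dataMeasure; infer_instance
  have hn' : (0 : ℝ) < n := Nat.cast_pos.2 hn
  set W : (Fin n → ℝ) → ℝ :=
    fun y => ∑ i, |T (y i) - ∫ z, T z ∂(expFamMeasure μ h T A (θ i))| with hW
  have hWm : Measurable W := by
    have hmT' : ∀ i, Measurable fun y : Fin n → ℝ => T (y i) := fun i =>
      hmT.comp (measurable_pi_apply i)
    simp only [hW]
    exact Finset.measurable_fun_sum _ fun i _ => ((hmT' i).sub_const _).abs
  have hWi : ∫⁻ y, ENNReal.ofReal (W y) ∂(dataMeasure μ h T A n θ) ≤ ENNReal.ofReal (n * M) := by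
    have h1 : ∀ y, ENNReal.ofReal (W y) =
        ∑ i, ENNReal.ofReal |T (y i) - ∫ z, T z ∂(expFamMeasure μ h T A (θ i))| := fun y =>
      ENNReal.ofReal_sum_of_nonneg fun i _ => abs_nonneg _
    have hm1 : ∀ i, Measurable fun z : ℝ =>
        ENNReal.ofReal |T z - ∫ z, T z ∂(expFamMeasure μ h T A (θ i))| := fun i =>
      (hmT.sub_const _).abs.ennreal_ofReal
    rw [lintegral_congr h1, lintegral_finsetSum (f := fun i (y : Fin n → ℝ) =>
      ENNReal.ofReal |T (y i) - ∫ z, T z ∂(expFamMeasure μ h T A (θ i))|) _ fun i _ =>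
      (hm1 i).comp (measurable_pi_apply i)]
    refine (Finset.sum_le_card_nsmul _ _ (ENNReal.ofReal M) fun i _ => ?_).trans ?_
    · refine (((measurePreserving_eval (fun i => expFamMeasure μ h T A (θ i)) i).lintegral_comp
        (hm1 i)).le).trans ?_
      exact lintegral_abs_sub_mean_le hM hh hmh hmT hJo hp (hθ i) (hA i)
    · rw [ENNReal.ofReal_mul hn'.le]
      simp
  have hbad : (dataMeasure μ h T A n θ) {y | M * n ^ 2 ≤ W y} ≤ ENNReal.ofReal (1 / n) := by
    have h1 := meas_ge_le_lintegral_div (μ := dataMeasure μ h T A n θ)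
      hWm.ennreal_ofReal.aemeasurable (ε := ENNReal.ofReal (M * n ^ 2))
      (by rw [Ne, ENNReal.ofReal_eq_zero, not_le]; positivity) ENNReal.ofReal_ne_top
    have h2 : {y | M * n ^ 2 ≤ W y} ⊆ {y | ENNReal.ofReal (M * n ^ 2) ≤ ENNReal.ofReal (W y)} :=
      fun y hy => ENNReal.ofReal_le_ofReal hy
    refine (measure_mono h2).trans (h1.trans ((ENNReal.div_le_div_right hWi _).trans ?_))
    rw [← ENNReal.ofReal_div_of_pos (by positivity)]
    refine ENNReal.ofReal_le_ofReal (le_of_eq ?_)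
    field_simp
  have hcompl : {y | W y < M * n ^ 2} = {y | M * n ^ 2 ≤ W y}ᶜ := by
    ext y; simp
  rw [hcompl, prob_compl_eq_one_sub (measurableSet_le measurable_const hWm),
    ENNReal.ofReal_sub _ (by positivity), ENNReal.ofReal_one]
  exact tsub_le_tsub_left hbad 1

end Likelihood

section Prior

variable {dn : ℕ} {lam a C r : ℝ} {S : Finset (Fin dn)} {b : Fin dn → ℝ}

theorem le_laplaceMeasure_Icc (hlam : 0 ≤ lam) (x : ℝ) :
    ENNReal.ofReal (lam * r * Real.exp (-(lam * |x|)) * Real.exp (-(lam * r))) ≤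
      laplaceMeasure lam (Set.Icc (x - r) (x + r)) := by
  rw [laplaceMeasure, withDensity_apply _ measurableSet_Icc]
  have h1 : ∫⁻ _ in Set.Icc (x - r) (x + r), ENNReal.ofReal
      (lam / 2 * Real.exp (-(lam * (|x| + r)))) ≤ ∫⁻ z in Set.Icc (x - r) (x + r),
      ENNReal.ofReal (lam / 2 * Real.exp (-(lam * |z|))) := by
    refine setLIntegral_mono (by fun_prop) fun z hz => ENNReal.ofReal_le_ofReal ?_
    have : |z| ≤ |x| + r := by
      have h2 : |z - x| ≤ r := abs_le.2 ⟨by linarith [hz.1], by linarith [hz.2]⟩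
      have h3 := abs_add_le x (z - x)
      rw [add_sub_cancel] at h3
      linarith
    gcongr
  refine le_trans (le_of_eq ?_) h1
  rw [setLIntegral_const, Real.volume_Icc, ← ENNReal.ofReal_mul (by positivity), mul_add,
    neg_add, Real.exp_add]
  congr 1
  ring

/-- The product of the intervals of radius `r` around `b j` for `j ∈ S`, and of the singletons
`{b j}` for `j ∉ S`. -/
def supportBox (S : Finset (Fin dn)) (b : Fin dn → ℝ) (r : ℝ) : Set (Fin dn → ℝ) :=
  Set.univ.pi fun j => Set.Icc (b j - if j ∈ S then r else 0) (b j + if j ∈ S then r else 0)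

theorem l1_sub_le_of_mem_supportBox {β : Fin dn → ℝ} (hβ : β ∈ supportBox S b r) :
    l1 (fun j => β j - b j) ≤ S.card * r := by
  have h1 : ∑ j, (if j ∈ S then r else 0) = S.card * r := by simp
  rw [l1, ← h1]
  refine Finset.sum_le_sum fun j _ => ?_
  have := hβ j (Set.mem_univ j)
  exact abs_le.2 ⟨by linarith [this.1], by linarith [this.2]⟩

theorem le_modelMeasure_supportBox (hlam : 0 ≤ lam) (hr : 0 ≤ r) (hb : ∀ j ∉ S, b j = 0) :
    ENNReal.ofReal ((lam * r) ^ S.card * Real.exp (-lam * l1 b) *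
      Real.exp (-(lam * (S.card * r)))) ≤ modelMeasure dn lam S (supportBox S b r) := by
  have hσ : ∀ j, SigmaFinite (if j ∈ S then laplaceMeasure lam else Measure.dirac (0 : ℝ)) := by
    intro j
    split_ifs
    · unfold laplaceMeasure; infer_instance
    · infer_instance
  rw [modelMeasure, supportBox, Measure.pi_pi]
  have hprod : (lam * r) ^ S.card * Real.exp (-lam * l1 b) * Real.exp (-(lam * (S.card * r))) =
      ∏ j, ((if j ∈ S then lam * r else 1) * Real.exp (-(lam * |b j|)) *
        Real.exp (-(lam * if j ∈ S then r else 0))) := by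
    rw [Finset.prod_mul_distrib, Finset.prod_mul_distrib, ← Real.exp_sum, ← Real.exp_sum,
      Finset.sum_neg_distrib, Finset.sum_neg_distrib, ← Finset.mul_sum, ← Finset.mul_sum, l1,
      neg_mul]
    congr 2
    · simp
    · simp
  rw [hprod, ENNReal.ofReal_prod_of_nonneg fun j _ => by positivity]
  refine Finset.prod_le_prod' fun j _ => ?_
  by_cases hj : j ∈ S
  · simp only [hj, if_true]
    exact le_laplaceMeasure_Icc hlam (b j)
  · simp [hj, hb j hj]

theorem le_priorMeasure (S : Finset (Fin dn)) (B : Set (Fin dn → ℝ)) :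
    ENNReal.ofReal (C * ((dn.choose S.card : ℝ))⁻¹ * ((dn : ℝ) ^ (-a)) ^ S.card) *
      modelMeasure dn lam S B ≤ priorMeasure dn lam a C B := by
  rw [priorMeasure, Measure.finsetSum_apply]
  exact Finset.single_le_sum (f := fun S : Finset (Fin dn) =>
    (ENNReal.ofReal (C * ((dn.choose S.card : ℝ))⁻¹ * ((dn : ℝ) ^ (-a)) ^ S.card) •
      modelMeasure dn lam S) B) (fun _ _ => zero_le) (Finset.mem_univ S)

theorem normalizer_le_one [IsProbabilityMeasure (priorMeasure dn lam a C)] :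
    C ≤ 1 := by
  have h1 := le_priorMeasure (lam := lam) (a := a) (C := C) (∅ : Finset (Fin dn)) Set.univ
  have h2 : modelMeasure dn lam ∅ Set.univ = 1 := by
    have : ∀ j : Fin dn, (if j ∈ (∅ : Finset (Fin dn)) then laplaceMeasure lam
        else Measure.dirac (0 : ℝ)) = Measure.dirac 0 := fun j => by simp
    simp only [modelMeasure, this]
    exact measure_univ
  rw [h2, measure_univ] at h1
  simpa using h1

end Prior

section Design

variable {n dn : ℕ} {X : Matrix (Fin n) (Fin dn) ℝ}

theorem abs_le_Xnorm (i : Fin n) (j : Fin dn) : |X i j| ≤ Xnorm X :=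
  (le_ciSup (f := fun j => |X i j|) (Set.finite_range _).bddAbove j).trans
    (le_ciSup (f := fun i => ⨆ j, |X i j|) (Set.finite_range _).bddAbove i)

theorem Xnorm_nonneg : 0 ≤ Xnorm X :=
  Real.iSup_nonneg fun _ => Real.iSup_nonneg fun _ => abs_nonneg _

theorem abs_etaVec_sub_le {ηf : ℝ → ℝ} (hlip : LipschitzWith 1 ηf) (β βstar : Fin dn → ℝ)
    (i : Fin n) :
    |etaVec ηf X β i - etaVec ηf X βstar i| ≤ Xnorm X * l1 (fun j => β j - βstar j) := by
  have h1 := hlip.dist_le_mul (∑ j, X i j * β j) (∑ j, X i j * βstar j)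
  rw [Real.dist_eq, Real.dist_eq, NNReal.coe_one, one_mul, ← Finset.sum_sub_distrib] at h1
  refine h1.trans ((Finset.abs_sum_le_sum_abs _ _).trans ?_)
  rw [l1, Finset.mul_sum]
  refine Finset.sum_le_sum fun j _ => ?_
  rw [← mul_sub, abs_mul]
  exact mul_le_mul_of_nonneg_right (abs_le_Xnorm i j) (abs_nonneg _)

end Design

/-- Lower bound for the prior mass of a small box around a vector supported on `S`. -/
theorem le_priorMeasure_supportBox {dn : ℕ} {lam a C r : ℝ} {S : Finset (Fin dn)}
    {b : Fin dn → ℝ} (hC : 0 ≤ C) (hd : 0 < dn) (hr : 0 ≤ r) (hb : ∀ j ∉ S, b j = 0)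
    (hlam : 0 ≤ lam) (hlr : ((dn : ℝ) ^ 4)⁻¹ ≤ lam * r) (hlr1 : lam * (S.card * r) ≤ 1) :
    ENNReal.ofReal (Real.exp (-1) * (C * (dn : ℝ) ^ (-((a + 6) * (S.card : ℝ))) *
      Real.exp (-lam * l1 b))) ≤ priorMeasure dn lam a C (supportBox S b r) := by
  refine le_trans ?_ (le_priorMeasure S _)
  refine le_trans ?_ (mul_le_mul_right (le_modelMeasure_supportBox hlam hr hb) _)
  have hd1 : (1 : ℝ) ≤ dn := by exact_mod_cast hd
  have hd0 : (0 : ℝ) < dn := by positivity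
  rw [← ENNReal.ofReal_mul (by positivity)]
  refine ENNReal.ofReal_le_ofReal ?_
  have hpow : (dn : ℝ) ^ (-((a + 6) * (S.card : ℝ))) =
      (((dn : ℝ) ^ 6)⁻¹) ^ S.card * ((dn : ℝ) ^ (-a)) ^ S.card := by
    rw [← mul_pow, ← Real.rpow_natCast (_ * _), neg_mul_eq_neg_mul, Real.rpow_mul hd0.le, neg_add,
      Real.rpow_add hd0, Real.rpow_neg hd0.le 6, mul_comm]
    norm_num
  have hch : ((dn : ℝ)⁻¹) ^ S.card ≤ ((dn.choose S.card : ℝ))⁻¹ := by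
    rw [inv_pow]
    have h1 : 0 < dn.choose S.card :=
      Nat.choose_pos (by simpa using Finset.card_le_univ S)
    exact inv_anti₀ (by exact_mod_cast h1) (by exact_mod_cast Nat.choose_le_pow dn S.card)
  have hsix : (((dn : ℝ) ^ 6)⁻¹) ^ S.card ≤
      ((dn.choose S.card : ℝ))⁻¹ * (lam * r) ^ S.card := by
    calc (((dn : ℝ) ^ 6)⁻¹) ^ S.card ≤ ((dn : ℝ)⁻¹ * ((dn : ℝ) ^ 4)⁻¹) ^ S.card := by
          gcongr
          rw [← mul_inv]
          refine inv_anti₀ (by positivity) ?_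
          rw [← pow_succ']
          exact pow_le_pow_right₀ hd1 (by norm_num)
      _ = ((dn : ℝ)⁻¹) ^ S.card * (((dn : ℝ) ^ 4)⁻¹) ^ S.card := mul_pow _ _ _
      _ ≤ _ := by gcongr
  have hexp : Real.exp (-1) ≤ Real.exp (-(lam * (S.card * r))) :=
    Real.exp_le_exp.2 (by linarith)
  rw [hpow]
  calc _ = C * ((((dn : ℝ) ^ 6)⁻¹) ^ S.card) * ((dn : ℝ) ^ (-a)) ^ S.card *
        Real.exp (-lam * l1 b) * Real.exp (-1) := by ring
    _ ≤ C * (((dn.choose S.card : ℝ))⁻¹ * (lam * r) ^ S.card) * ((dn : ℝ) ^ (-a)) ^ S.card *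
        Real.exp (-lam * l1 b) * Real.exp (-(lam * (S.card * r))) := by gcongr
    _ = _ := by ring

/-- The marginal likelihood bound on the event where the likelihood ratio is integrable and the
total absolute centred statistic is controlled. -/
theorem le_marginalLik {μ : Measure ℝ} {h T A ηf : ℝ → ℝ} {J : Set ℝ} {n dn : ℕ}
    {X : Matrix (Fin n) (Fin dn) ℝ} {βstar : Fin dn → ℝ} {y : Fin n → ℝ} {M0 lam a C : ℝ}
    (hM0 : 0 < M0) (hJo : IsOpen J) (hJ : J.OrdConnected) (hA : ContDiffOn ℝ 2 A J)
    (hK : ∀ x ∈ J, deriv (deriv A) x ≤ M0 ^ 2 / 2) (hηJ : ∀ t, ηf t ∈ J)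
    (hlip : LipschitzWith 1 ηf) (hn : 0 < n) (hnd : n < dn) (hlog : Real.log dn ≤ n)
    (hC : 0 ≤ C) (ha : 0 ≤ a) [IsProbabilityMeasure (priorMeasure dn lam a C)]
    (hlam1 : Mconst M0 X / dn ≤ lam) (hlam2 : lam ≤ Mconst M0 X * Real.sqrt (Real.log dn))
    (hs : 0 < (suppSet βstar).card)
    (hint : Integrable (fun β => Real.exp (logLR μ h T A ηf X βstar β y))
      (priorMeasure dn lam a C))
    (hy : ∑ i, |T (y i) - ∫ z, T z ∂(expFamMeasure μ h T A (etaVec ηf X βstar i))| <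
      M0 * n ^ 2) :
    Real.exp (-3) * C * (dn : ℝ) ^ (-((a + 6) * ((suppSet βstar).card : ℝ))) *
      Real.exp (-lam * l1 βstar) ≤ marginalLik μ h T A ηf dn X βstar lam a C y := by
  have hn1 : (1 : ℝ) ≤ n := by exact_mod_cast hn
  have hnd' : (n : ℝ) ≤ dn := by exact_mod_cast hnd.le
  have hd1 : (1 : ℝ) ≤ dn := hn1.trans hnd'
  set m1 : ℝ := (min 1 M0⁻¹)⁻¹ with hm1
  have hmin : 0 < min 1 M0⁻¹ := lt_min one_pos (inv_pos.2 hM0)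
  have hm1pos : 0 < m1 := inv_pos.2 hmin
  have hM0m1 : M0 ≤ m1 := by
    rw [hm1, le_inv_comm₀ hM0 hmin]; exact min_le_right _ _
  have hMdef : Mconst M0 X = Xnorm X * m1 := rfl
  have hM : 0 ≤ Mconst M0 X := mul_nonneg Xnorm_nonneg hm1pos.le
  have hlam : 0 ≤ lam := le_trans (by positivity) hlam1
  have hl1 : 0 ≤ l1 βstar := Finset.sum_nonneg fun _ _ => abs_nonneg _
  set s : ℝ := ((suppSet βstar).card : ℝ) with hsdef
  have hs1 : 1 ≤ s := by rw [hsdef]; exact_mod_cast hs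
  have hsd : s ≤ dn := by
    have := Finset.card_le_univ (suppSet βstar)
    rw [Fintype.card_fin] at this
    rw [hsdef]; exact_mod_cast this
  rcases (Xnorm_nonneg (X := X)).eq_or_lt with hX | hX
  · have hL : ∀ β, 0 ≤ logLR μ h T A ηf X βstar β y := fun β => by
      have := neg_le_logLR (μ := μ) (h := h) (T := T) (X := X) (βstar := βstar) (β := β) (y := y)
        (δ := 0) (by positivity) hJo hJ hA hK hηJ
        fun i => (abs_etaVec_sub_le hlip β βstar i).trans (by rw [← hX, zero_mul])
      simpa using this
    have h1 : (1 : ℝ) ≤ marginalLik μ h T A ηf dn X βstar lam a C y := by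
      have := integral_mono (integrable_const (1 : ℝ)) hint fun β => Real.one_le_exp (hL β)
      simpa [marginalLik] using this
    refine le_trans ?_ h1
    have h2 : Real.exp (-3) ≤ 1 := Real.exp_le_one_iff.2 (by norm_num)
    have h3 : (dn : ℝ) ^ (-((a + 6) * s)) ≤ 1 :=
      Real.rpow_le_one_of_one_le_of_nonpos hd1 (neg_nonpos.2 (by positivity))
    have h4 : Real.exp (-lam * l1 βstar) ≤ 1 :=
      Real.exp_le_one_iff.2 (by rw [neg_mul]; exact neg_nonpos.2 (mul_nonneg hlam hl1))
    have hC1 : C ≤ 1 := normalizer_le_one (lam := lam) (a := a) (dn := dn)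
    exact mul_le_one₀ (mul_le_one₀ (mul_le_one₀ h2 hC hC1) (by positivity) h3) (by positivity) h4
  · have hMpos : 0 < Mconst M0 X := mul_pos hX hm1pos
    set r : ℝ := 1 / (Mconst M0 X * n ^ 2 * s) with hr
    have hr0 : 0 ≤ r := by positivity
    have hsr : s * r = 1 / (Mconst M0 X * n ^ 2) := by
      rw [hr]; field_simp
    have hlr : ((dn : ℝ) ^ 4)⁻¹ ≤ lam * r := by
      have h1 : (dn : ℝ) * n ^ 2 * s ≤ (dn : ℝ) ^ 4 := by
        calc (dn : ℝ) * n ^ 2 * s ≤ (dn : ℝ) * dn ^ 2 * dn := by gcongr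
          _ = (dn : ℝ) ^ 4 := by ring
      calc ((dn : ℝ) ^ 4)⁻¹ ≤ ((dn : ℝ) * n ^ 2 * s)⁻¹ := inv_anti₀ (by positivity) h1
        _ = Mconst M0 X / dn * r := by rw [hr]; field_simp
        _ ≤ lam * r := by gcongr
    have hlr1 : lam * (s * r) ≤ 1 := by
      have h1 : Real.sqrt (Real.log dn) ≤ n ^ 2 := by
        rw [Real.sqrt_le_left (by positivity)]
        calc Real.log dn ≤ n := hlog
          _ ≤ (n : ℝ) ^ 4 := le_self_pow₀ hn1 (by norm_num)
          _ = _ := by ring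
      rw [hsr]
      calc lam * (1 / (Mconst M0 X * n ^ 2)) ≤
            (Mconst M0 X * n ^ 2) * (1 / (Mconst M0 X * n ^ 2)) := by
            gcongr
            exact hlam2.trans (by gcongr)
        _ = 1 := by field_simp
    have hbox := le_priorMeasure_supportBox (a := a) (b := βstar) (S := suppSet βstar) hC
      (hn.trans hnd) hr0 (fun j hj => by simpa [suppSet] using hj) hlam hlr hlr1
    set δ : ℝ := 1 / (m1 * n ^ 2) with hδ
    have hsub : supportBox (suppSet βstar) βstar r ⊆
        {β | Real.exp (-2) ≤ Real.exp (logLR μ h T A ηf X βstar β y)} := fun β hβ => by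
      refine Real.exp_le_exp.2 ?_
      have hδi : ∀ i, |etaVec ηf X β i - etaVec ηf X βstar i| ≤ δ := fun i => by
        refine (abs_etaVec_sub_le hlip β βstar i).trans ?_
        calc Xnorm X * l1 (fun j => β j - βstar j) ≤ Xnorm X * (s * r) :=
              mul_le_mul_of_nonneg_left (l1_sub_le_of_mem_supportBox hβ) hX.le
          _ = δ := by rw [hsr, hMdef, hδ]; field_simp
      refine le_trans ?_ (neg_le_logLR (K := M0 ^ 2 / 2) (by positivity) hJo hJ hA hK hηJ hδi)
      have hq : M0 / m1 ≤ 1 := (div_le_one hm1pos).2 hM0m1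
      have hq0 : 0 ≤ M0 / m1 := by positivity
      have h1 : (∑ i, |T (y i) - ∫ z, T z ∂(expFamMeasure μ h T A (etaVec ηf X βstar i))|) * δ ≤
          1 := by
        calc _ ≤ M0 * n ^ 2 * δ := by gcongr
          _ = M0 / m1 := by rw [hδ]; field_simp
          _ ≤ 1 := hq
      have h2 : (n : ℝ) * (M0 ^ 2 / 2 / 2 * δ ^ 2) ≤ 1 := by
        calc (n : ℝ) * (M0 ^ 2 / 2 / 2 * δ ^ 2) = (M0 / m1) ^ 2 * (1 / (4 * n ^ 3)) := by
              rw [hδ]; field_simp; ring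
          _ ≤ 1 * 1 := by
              gcongr
              · exact pow_le_one₀ hq0 hq
              · rw [div_le_one (by positivity)]
                nlinarith [one_le_pow₀ (n := 3) hn1]
          _ = 1 := one_mul 1
      linarith
    have hmarkov := mul_meas_ge_le_integral_of_nonneg
      (ae_of_all _ fun β => (Real.exp_pos (logLR μ h T A ηf X βstar β y)).le) hint (Real.exp (-2))
    refine le_trans ?_ hmarkov
    have hreal := (ENNReal.ofReal_le_iff_le_toReal (measure_ne_top _ _)).1
      (hbox.trans (measure_mono hsub))
    calc _ = Real.exp (-2) * (Real.exp (-1) * (C * (dn : ℝ) ^ (-((a + 6) * s)) *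
          Real.exp (-lam * l1 βstar))) := by
          rw [show (-3 : ℝ) = -2 + -1 by norm_num, Real.exp_add]; ring
      _ ≤ _ := mul_le_mul_of_nonneg_left hreal (Real.exp_pos _).le

/-- **Theorem 1** (lower bound of the marginal likelihood). -/
theorem theorem1_marginal_likelihood_lower_bound
    (μ : Measure ℝ) [SigmaFinite μ]
    (h T A ηf : ℝ → ℝ) (M0 : ℝ) (hM0 : 0 < M0)
    (domA : Set ℝ) (hdomA : Convex ℝ domA) (hrange : ∀ t : ℝ, ηf t ∈ domA)
    (hconv : ConvexOn ℝ domA A) (hsmooth : ContDiffOn ℝ 2 A domA)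
    (hhpos : ∀ y, 0 ≤ h y) (hmh : Measurable h) (hmT : Measurable T)
    (hlogpart : ∀ θ ∈ domA, Real.exp (A θ) = ∫ y, h y * Real.exp (θ * T y) ∂μ)
    (hprob : ∀ θ ∈ domA, IsProbabilityMeasure (expFamMeasure μ h T A θ))
    (hIA : ∀ c : ℝ, 0 < c →
      ({t : ℝ | 0 ≤ deriv (deriv A) t ∧ deriv (deriv A) t ≤ c} : Set ℝ).OrdConnected)
    (hIAtop : ({t : ℝ | 0 ≤ deriv (deriv A) t} : Set ℝ).OrdConnected)
    (hclip : ∀ t : ℝ, 0 ≤ deriv (deriv A) (ηf t) ∧ deriv (deriv A) (ηf t) ≤ M0 ^ 2 / 2)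
    (hlip : LipschitzWith 1 ηf) (hinj : Function.Injective ηf)
    (d : ℕ → ℕ) (hdgt : ∀ n, n < d n)
    (hdinf : Tendsto (fun n => (d n : ℝ)) atTop atTop)
    (b : ℕ → ℝ) (hbpos : ∀ n, 0 < b n)
    (hbo : Tendsto (fun n => b n * Real.log (d n) / n) atTop (nhds 0))
    (X : ∀ n : ℕ, Matrix (Fin n) (Fin (d n)) ℝ)
    (lam a C : ℕ → ℝ) (hCpos : ∀ n, 0 < C n)
    (hL0 : ∀ n, Mconst M0 (X n) / (d n : ℝ) ≤ lam n ∧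
      lam n ≤ Mconst M0 (X n) * Real.sqrt (Real.log (d n)))
    (hprior : ∀ n, IsProbabilityMeasure (priorMeasure (d n) (lam n) (a n) (C n)))
    (ha : ∀ n, 0 < a n)
    (βstar : ∀ n : ℕ, Fin (d n) → ℝ)
    (hβstar : ∀ n, 0 < (suppSet (βstar n)).card ∧ ((suppSet (βstar n)).card : ℝ) ≤ b n) :
    ∃ c : ℝ, 0 < c ∧ ∀ᶠ n in atTop,
      ENNReal.ofReal (1 - 1 / (((suppSet (βstar n)).card : ℝ) * Real.log (d n))) ≤
        dataMeasure μ h T A n (etaVec ηf (X n) (βstar n))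
          {y | c * C n * (d n : ℝ) ^ (-((a n + 6) * ((suppSet (βstar n)).card : ℝ))) *
              Real.exp (-(lam n) * l1 (βstar n)) ≤
            marginalLik μ h T A ηf (d n) (X n) (βstar n) (lam n) (a n) (C n) y} := by
  set J : Set ℝ := Set.range ηf with hJdef
  have hcont : Continuous ηf := hlip.continuous
  have hJo : IsOpen J := isOpen_range_of_continuous_injective hcont hinj
  have hJ : J.OrdConnected := (isPreconnected_range hcont).ordConnected
  have hJsub : J ⊆ domA := by rintro _ ⟨t, rfl⟩; exact hrange t
  have hηJ : ∀ t, ηf t ∈ J := fun t => ⟨t, rfl⟩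
  have hA : ContDiffOn ℝ 2 A J := hsmooth.mono hJsub
  have hp : ∀ θ ∈ J, IsProbabilityMeasure (expFamMeasure μ h T A θ) :=
    fun θ hθ => hprob θ (hJsub hθ)
  have hK : ∀ x ∈ J, deriv (deriv A) x ≤ M0 ^ 2 / 2 := by rintro _ ⟨t, rfl⟩; exact (hclip t).2
  have hAη : Measurable fun t => A (ηf t) :=
    (hA.continuousOn.comp_continuous hcont hηJ).measurable
  refine ⟨Real.exp (-3), Real.exp_pos _, ?_⟩
  filter_upwards [hbo.eventually (gt_mem_nhds one_pos), eventually_gt_atTop 0] with n hbn hn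
  have hn' : (0 : ℝ) < n := Nat.cast_pos.2 hn
  obtain ⟨hs, hsb⟩ := hβstar n
  have hs1 : (1 : ℝ) ≤ ((suppSet (βstar n)).card : ℝ) := by exact_mod_cast hs
  have hd1 : (1 : ℝ) < d n := by
    exact_mod_cast lt_of_le_of_lt (Nat.one_le_iff_ne_zero.2 hn.ne') (hdgt n)
  have hlogpos : 0 < Real.log (d n) := Real.log_pos hd1
  have hslog : ((suppSet (βstar n)).card : ℝ) * Real.log (d n) ≤ n := by
    rw [div_lt_one hn'] at hbn
    exact (mul_le_mul_of_nonneg_right hsb hlogpos.le).trans hbn.le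
  have hlog : Real.log (d n) ≤ n := (le_mul_of_one_le_left hlogpos.le hs1).trans hslog
  have := hprior n
  refine le_trans (ENNReal.ofReal_le_ofReal ?_) ((one_sub_le_dataMeasure hM0 hhpos hmh hmT hJo hp
    (θ := etaVec ηf (X n) (βstar n)) (fun i => hηJ _)
    (fun i => (hK _ (hηJ _)).trans (half_le_self (by positivity))) hn).trans
    (measure_mono_ae ?_))
  · exact sub_le_sub_left (one_div_le_one_div_of_le (by positivity) hslog) 1
  · filter_upwards [ae_integrable_exp_logLR (X := X n) (βstar := βstar n) hhpos hmh hmT hJo hp hηJ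
      hcont hAη (priorMeasure (d n) (lam n) (a n) (C n))] with y hint hy
    exact le_marginalLik hM0 hJo hJ hA hK hηJ hlip hn (hdgt n) hlog (hCpos n).le (ha n).le
      (hL0 n).1 (hL0 n).2 hs hint hy
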